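/- Let M be a model category. Consider a natural transformation between pushout diagrams, i.e. a commutative diagram consisting of morphisms f_k : A_k → B_k (k = 0, 1, 2) between rows A_0 ← A_1 → A_2 and B_0 ← B_1 → B_2, where each f_k is a weak equivalence and all objects A_k, B_k are cofibrant. If A_1 → A_2 is a cofibration and at least one of B_1 → B_2 or B_1 → B_0 is a cofibration, then the induced morphism of pushouts f : colim(A_0 ← A_1 → A_2) → colim(B_0 ← B_1 → B_2) is a weak equivalence. -/

import Mathlib

open CategoryTheory CategoryTheory.Limits

universe w v u v₂ u₂ v₃ u₃

/-- A morphism `f` is a retract of a morphism `g` (in the arrow category). -/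
def IsRetractOfArrow {C : Type*} [Category C] {X Y X' Y' : C}
    (f : X ⟶ Y) (g : X' ⟶ Y') : Prop :=
  ∃ (a : X ⟶ X') (a' : X' ⟶ X) (b : Y ⟶ Y') (b' : Y' ⟶ Y),
    a ≫ a' = 𝟙 X ∧ b ≫ b' = 𝟙 Y ∧ a ≫ g = f ≫ b ∧ a' ≫ f = g ≫ b'

/-- A (Quillen) model structure on a category `M`: three distinguished classes of
morphisms (weak equivalences, fibrations and cofibrations) subject to the axioms
MC2–MC5 (two-out-of-three, retract stability, lifting and factorization).
Bicompleteness (MC1) is imposed separately via `HasLimits`/`HasColimits`. -/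
structure ModelStructure (M : Type u) [Category.{v} M] where
  weq : MorphismProperty M
  fib : MorphismProperty M
  cof : MorphismProperty M
  weq_of_isIso : ∀ {X Y : M} (f : X ⟶ Y), IsIso f → weq f
  weq_comp : ∀ {X Y Z : M} (f : X ⟶ Y) (g : Y ⟶ Z), weq f → weq g → weq (f ≫ g)
  weq_of_comp_left : ∀ {X Y Z : M} (f : X ⟶ Y) (g : Y ⟶ Z), weq f → weq (f ≫ g) → weq g
  weq_of_comp_right : ∀ {X Y Z : M} (f : X ⟶ Y) (g : Y ⟶ Z), weq g → weq (f ≫ g) → weq f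
  weq_retract : ∀ {X Y X' Y' : M} {f : X ⟶ Y} {g : X' ⟶ Y'},
    IsRetractOfArrow f g → weq g → weq f
  fib_retract : ∀ {X Y X' Y' : M} {f : X ⟶ Y} {g : X' ⟶ Y'},
    IsRetractOfArrow f g → fib g → fib f
  cof_retract : ∀ {X Y X' Y' : M} {f : X ⟶ Y} {g : X' ⟶ Y'},
    IsRetractOfArrow f g → cof g → cof f
  lifting_cof_acyclicFib : ∀ {A B X Y : M} (i : A ⟶ B) (p : X ⟶ Y),
    cof i → fib p → weq p → HasLiftingProperty i p
  lifting_acyclicCof_fib : ∀ {A B X Y : M} (i : A ⟶ B) (p : X ⟶ Y),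
    cof i → weq i → fib p → HasLiftingProperty i p
  factorization_cof_acyclicFib : ∀ {X Y : M} (f : X ⟶ Y),
    ∃ (Z : M) (i : X ⟶ Z) (p : Z ⟶ Y), cof i ∧ fib p ∧ weq p ∧ i ≫ p = f
  factorization_acyclicCof_fib : ∀ {X Y : M} (f : X ⟶ Y),
    ∃ (Z : M) (i : X ⟶ Z) (p : Z ⟶ Y), cof i ∧ weq i ∧ fib p ∧ i ≫ p = f

variable {M : Type u} [Category.{v} M]

/-- An object is cofibrant if the map from the initial object to it is a cofibration. -/
def ModelStructure.Cofibrant [HasInitial M] (ms : ModelStructure M) (A : M) : Prop :=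
  ms.cof (initial.to A)

/-- An object is fibrant if the map to the terminal object is a fibration. -/
def ModelStructure.Fibrant [HasTerminal M] (ms : ModelStructure M) (X : M) : Prop :=
  ms.fib (terminal.from X)


open HomotopicalAlgebra

attribute [local simp] pushout.inl_desc pushout.inr_desc pushout.inl_desc_assoc
  pushout.inr_desc_assoc coprod.inl_desc coprod.inr_desc coprod.inl_desc_assoc
  coprod.inr_desc_assoc pullback.lift_fst pullback.lift_snd pullback.lift_fst_assoc
  pullback.lift_snd_assoc pushout.map

section GluingAux

variable {C : Type u} [Category.{v} C] [ModelCategory C]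

lemma aux_fact {X Y : C} (f : X ⟶ Y) : ∃ (Z : C) (i : X ⟶ Z) (p : Z ⟶ Y),
    Cofibration i ∧ Fibration p ∧ WeakEquivalence p ∧ i ≫ p = f := by
  have h := MorphismProperty.factorizationData (cofibrations C) (trivialFibrations C) f
  obtain ⟨h1, h2⟩ := (mem_trivialFibrations_iff _).1 h.hp
  exact ⟨h.Z, h.i, h.p, (cofibration_iff _).2 h.hi, h1, h2, h.fac⟩

/-- The case of a relative (Reedy) acyclic cofibration of spans. -/
lemma aux_acyclic {A₀ A₁ A₂ Z₀ Z₁ Z₂ : C}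
    (a₀ : A₁ ⟶ A₀) (a₂ : A₁ ⟶ A₂) (z₀ : Z₁ ⟶ Z₀) (z₂ : Z₁ ⟶ Z₂)
    (j₀ : A₀ ⟶ Z₀) (j₁ : A₁ ⟶ Z₁) (j₂ : A₂ ⟶ Z₂)
    (e₀ : a₀ ≫ j₀ = j₁ ≫ z₀) (e₂ : a₂ ≫ j₂ = j₁ ≫ z₂)
    [Cofibration j₀] [WeakEquivalence j₀] [Cofibration j₁] [WeakEquivalence j₁]
    [WeakEquivalence j₂] [Cofibration (pushout.desc j₂ z₂ e₂)] :
    WeakEquivalence (pushout.map a₀ a₂ z₀ z₂ j₀ j₂ j₁ e₀ e₂) := by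
  have : WeakEquivalence (pushout.desc j₂ z₂ e₂) :=
    weakEquivalence_of_precomp_of_fac (pushout.inl_desc j₂ z₂ e₂)
  suffices h : trivialCofibrations C (pushout.map a₀ a₂ z₀ z₂ j₀ j₂ j₁ e₀ e₂) from
    ((mem_trivialCofibrations_iff _).1 h).2
  rw [← fibrations_llp]
  intro X Y p hp
  rw [← fibration_iff] at hp
  constructor
  intro t b sq
  have hw := sq.w
  have w0 : (pushout.inl a₀ a₂ ≫ t) ≫ p = j₀ ≫ (pushout.inl z₀ z₂ ≫ b) := by
    have := pushout.inl a₀ a₂ ≫= hw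
    simpa using this
  have w2 : (pushout.inr a₀ a₂ ≫ t) ≫ p = j₂ ≫ (pushout.inr z₀ z₂ ≫ b) := by
    have := pushout.inr a₀ a₂ ≫= hw
    simpa using this
  have sq0 : CommSq (pushout.inl a₀ a₂ ≫ t) j₀ p (pushout.inl z₀ z₂ ≫ b) := ⟨w0⟩
  have c : a₂ ≫ (pushout.inr a₀ a₂ ≫ t) = j₁ ≫ (z₀ ≫ sq0.lift) := by
    rw [← Category.assoc j₁, ← e₀, Category.assoc, sq0.fac_left, ← Category.assoc,
      ← Category.assoc, pushout.condition]
  have sq2 : CommSq (pushout.desc (pushout.inr a₀ a₂ ≫ t) (z₀ ≫ sq0.lift) c)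
      (pushout.desc j₂ z₂ e₂) p (pushout.inr z₀ z₂ ≫ b) := ⟨by
    apply pushout.hom_ext
    · simpa using w2
    · simp [pushout.condition_assoc]⟩
  have l1 : z₂ ≫ sq2.lift = z₀ ≫ sq0.lift := by
    have := pushout.inr _ _ ≫= sq2.fac_left
    rwa [pushout.inr_desc_assoc, pushout.inr_desc] at this
  have l2 : j₂ ≫ sq2.lift = pushout.inr a₀ a₂ ≫ t := by
    have := pushout.inl _ _ ≫= sq2.fac_left
    rwa [pushout.inl_desc_assoc, pushout.inl_desc] at this
  refine ⟨⟨⟨pushout.desc sq0.lift sq2.lift l1.symm, ?_, ?_⟩⟩⟩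
  · apply pushout.hom_ext <;> simp [l2]
  · apply pushout.hom_ext <;> simp

lemma aux_glue {A₀ A₁ A₂ B₀ B₁ B₂ : C}
    (a₀ : A₁ ⟶ A₀) (a₂ : A₁ ⟶ A₂) (b₀ : B₁ ⟶ B₀) (b₂ : B₁ ⟶ B₂)
    (f₀ : A₀ ⟶ B₀) (f₁ : A₁ ⟶ B₁) (f₂ : A₂ ⟶ B₂)
    (e₀ : a₀ ≫ f₀ = f₁ ≫ b₀) (e₂ : a₂ ≫ f₂ = f₁ ≫ b₂)
    [WeakEquivalence f₀] [WeakEquivalence f₁] [WeakEquivalence f₂]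
    [IsCofibrant A₀] [IsCofibrant A₁] [IsCofibrant B₀] [IsCofibrant B₁]
    [Cofibration a₂] [Cofibration b₂] :
    WeakEquivalence (pushout.map a₀ a₂ b₀ b₂ f₀ f₂ f₁ e₀ e₂) := by
  obtain ⟨Z₀, i₀, p₀, _, _, _, h₀⟩ := aux_fact (coprod.desc f₀ (𝟙 B₀))
  have hj₀ : (coprod.inl ≫ i₀) ≫ p₀ = f₀ := by simp [h₀]
  have hs₀ : (coprod.inr ≫ i₀) ≫ p₀ = 𝟙 B₀ := by simp [h₀]
  have cj₀ : Cofibration (coprod.inl ≫ i₀) := inferInstance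
  have cs₀ : Cofibration (coprod.inr ≫ i₀) := inferInstance
  generalize (coprod.inl ≫ i₀) = j₀ at *
  generalize (coprod.inr ≫ i₀) = s₀ at *
  obtain ⟨Z₁, i₁, q₁, _, _, _, h₁⟩ := aux_fact
    (coprod.desc (pullback.lift (a₀ ≫ j₀) f₁ (by simp [hj₀, e₀]))
      (pullback.lift (b₀ ≫ s₀) (𝟙 B₁) (by simp [hs₀])) : A₁ ⨿ B₁ ⟶ pullback p₀ b₀)
  have hj₁ : (coprod.inl ≫ i₁) ≫ (q₁ ≫ pullback.snd p₀ b₀) = f₁ := by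
    simp [reassoc_of% h₁]
  have hs₁ : (coprod.inr ≫ i₁) ≫ (q₁ ≫ pullback.snd p₀ b₀) = 𝟙 B₁ := by
    simp [reassoc_of% h₁]
  have ej₀ : a₀ ≫ j₀ = (coprod.inl ≫ i₁) ≫ (q₁ ≫ pullback.fst p₀ b₀) := by
    simp [reassoc_of% h₁]
  have es₀ : b₀ ≫ s₀ = (coprod.inr ≫ i₁) ≫ (q₁ ≫ pullback.fst p₀ b₀) := by
    simp [reassoc_of% h₁]
  have ep₀ : (q₁ ≫ pullback.fst p₀ b₀) ≫ p₀ = (q₁ ≫ pullback.snd p₀ b₀) ≫ b₀ := by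
    simp [pullback.condition]
  have wp₁ : WeakEquivalence (q₁ ≫ pullback.snd p₀ b₀) := inferInstance
  have cj₁ : Cofibration (coprod.inl ≫ i₁) := inferInstance
  have cs₁ : Cofibration (coprod.inr ≫ i₁) := inferInstance
  generalize (coprod.inl ≫ i₁) = j₁ at *
  generalize (coprod.inr ≫ i₁) = s₁ at *
  generalize (q₁ ≫ pullback.fst p₀ b₀) = z₀ at *
  generalize (q₁ ≫ pullback.snd p₀ b₀) = p₁ at *
  obtain ⟨Z₂, i₂, p₂, _, _, _, h₂⟩ := aux_fact
    (pushout.desc (pushout.desc f₂ (p₁ ≫ b₂) (by rw [e₂, ← hj₁, Category.assoc]))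
      (pushout.desc (𝟙 B₂) (p₁ ≫ b₂) (by rw [reassoc_of% hs₁, Category.comp_id])) (by simp) :
      pushout (pushout.inr a₂ j₁) (pushout.inr b₂ s₁) ⟶ B₂)
  let kA : pushout a₂ j₁ ⟶ Z₂ := pushout.inl _ _ ≫ i₂
  let kB : pushout b₂ s₁ ⟶ Z₂ := pushout.inr _ _ ≫ i₂
  let z₂ : Z₁ ⟶ Z₂ := pushout.inr _ _ ≫ kA
  let j₂ : A₂ ⟶ Z₂ := pushout.inl _ _ ≫ kA
  let s₂ : B₂ ⟶ Z₂ := pushout.inl _ _ ≫ kB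
  have hz₂ : z₂ = pushout.inr _ _ ≫ kB := by simp [z₂, kA, kB, pushout.condition_assoc]
  have ej₂ : a₂ ≫ j₂ = j₁ ≫ z₂ := by simp [j₂, z₂, pushout.condition_assoc]
  have es₂ : b₂ ≫ s₂ = s₁ ≫ z₂ := by rw [hz₂]; simp [s₂, pushout.condition_assoc]
  have hj₂ : j₂ ≫ p₂ = f₂ := by simp [j₂, kA, h₂]
  have hs₂ : s₂ ≫ p₂ = 𝟙 B₂ := by simp [s₂, kB, h₂]
  have ep₂ : z₂ ≫ p₂ = p₁ ≫ b₂ := by simp [z₂, kA, h₂]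
  have ckA : Cofibration (pushout.desc j₂ z₂ ej₂) := by
    have : pushout.desc j₂ z₂ ej₂ = kA := by apply pushout.hom_ext <;> simp [j₂, z₂]
    rw [this]; infer_instance
  have ckB : Cofibration (pushout.desc s₂ z₂ es₂) := by
    have : pushout.desc s₂ z₂ es₂ = kB := by apply pushout.hom_ext <;> simp [s₂, hz₂]
    rw [this]; infer_instance
  have := weakEquivalence_of_postcomp_of_fac hj₀
  have := weakEquivalence_of_postcomp_of_fac hj₁
  have := weakEquivalence_of_postcomp_of_fac hj₂
  have := weakEquivalence_of_postcomp_of_fac hs₀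
  have := weakEquivalence_of_postcomp_of_fac hs₁
  have := weakEquivalence_of_postcomp_of_fac hs₂
  have wj := aux_acyclic a₀ a₂ z₀ z₂ j₀ j₁ j₂ ej₀ ej₂
  have ws := aux_acyclic b₀ b₂ z₀ z₂ s₀ s₁ s₂ es₀ es₂
  have fs : pushout.map b₀ b₂ z₀ z₂ s₀ s₂ s₁ es₀ es₂ ≫
      pushout.map z₀ z₂ b₀ b₂ p₀ p₂ p₁ ep₀ ep₂ = 𝟙 _ := by
    apply pushout.hom_ext <;> simp [reassoc_of% hs₀, reassoc_of% hs₂]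
  have fj : pushout.map a₀ a₂ z₀ z₂ j₀ j₂ j₁ ej₀ ej₂ ≫
      pushout.map z₀ z₂ b₀ b₂ p₀ p₂ p₁ ep₀ ep₂ =
      pushout.map a₀ a₂ b₀ b₂ f₀ f₂ f₁ e₀ e₂ := by
    apply pushout.hom_ext <;> simp [reassoc_of% hj₀, reassoc_of% hj₂]
  have := weakEquivalence_of_precomp_of_fac fs
  rw [← fj]
  infer_instance

lemma aux_cof_comp {X Y : C} (f : X ⟶ Y) [hX : IsCofibrant X] [Cofibration f] :
    IsCofibrant Y := by
  have : initial.to Y = initial.to X ≫ f := Subsingleton.elim _ _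
  have h : Cofibration (initial.to X ≫ f) := inferInstance
  rw [← this] at h
  exact h

lemma aux_glue' {A₀ A₁ A₂ B₀ B₁ B₂ : C}
    (a₀ : A₁ ⟶ A₀) (a₂ : A₁ ⟶ A₂) (b₀ : B₁ ⟶ B₀) (b₂ : B₁ ⟶ B₂)
    (f₀ : A₀ ⟶ B₀) (f₁ : A₁ ⟶ B₁) (f₂ : A₂ ⟶ B₂)
    (e₀ : a₀ ≫ f₀ = f₁ ≫ b₀) (e₂ : a₂ ≫ f₂ = f₁ ≫ b₂)
    [WeakEquivalence f₀] [WeakEquivalence f₁] [WeakEquivalence f₂]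
    [IsCofibrant A₀] [IsCofibrant A₁] [IsCofibrant B₀] [IsCofibrant B₁] [IsCofibrant B₂]
    [Cofibration a₂] [Cofibration b₀] :
    WeakEquivalence (pushout.map a₀ a₂ b₀ b₂ f₀ f₂ f₁ e₀ e₂) := by
  -- `D = B₁ ⊔_{A₁} A₂`
  have hD : IsCofibrant (pushout f₁ a₂) := aux_cof_comp (pushout.inl f₁ a₂)
  have w1 : WeakEquivalence (pushout.inr f₁ a₂) := by
    have h1 := aux_glue (𝟙 A₁) a₂ f₁ a₂ f₁ (𝟙 A₁) (𝟙 A₂) (by simp) (by simp)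
    have h2 : pushout.inr (𝟙 A₁) a₂ ≫
      pushout.map (𝟙 A₁) a₂ f₁ a₂ f₁ (𝟙 A₂) (𝟙 A₁) (by simp) (by simp) =
      pushout.inr f₁ a₂ := by simp
    rw [← h2]
    infer_instance
  let g : pushout f₁ a₂ ⟶ B₂ := pushout.desc b₂ f₂ e₂.symm
  have hg : pushout.inr f₁ a₂ ≫ g = f₂ := by simp [g]
  have hg' : pushout.inl f₁ a₂ ≫ g = b₂ := by simp [g]
  have w2 : WeakEquivalence g := weakEquivalence_of_precomp_of_fac hg
  have w3 := aux_glue a₀ a₂ b₀ (pushout.inl f₁ a₂) f₀ f₁ (pushout.inr f₁ a₂) e₀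
    pushout.condition.symm
  have w4 := aux_glue (pushout.inl f₁ a₂) b₀ b₂ b₀ g (𝟙 B₁) (𝟙 B₀)
    (by simp [hg']) (by simp)
  have e : pushout.map a₀ a₂ b₀ b₂ f₀ f₂ f₁ e₀ e₂ =
      pushout.map a₀ a₂ b₀ (pushout.inl f₁ a₂) f₀ (pushout.inr f₁ a₂) f₁ e₀
        pushout.condition.symm ≫ (pushoutSymmetry _ _).hom ≫
      pushout.map (pushout.inl f₁ a₂) b₀ b₂ b₀ g (𝟙 B₀) (𝟙 B₁)
        (by simp [hg']) (by simp) ≫ (pushoutSymmetry _ _).hom := by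
    apply pushout.hom_ext <;> simp [reassoc_of% hg]
  rw [e]
  infer_instance

end GluingAux

/-- The Mathlib model category attached to a model structure. -/
@[reducible]
def ModelStructure.toModelCategory {M : Type u} [Category.{v} M] [HasLimits M] [HasColimits M]
    (ms : ModelStructure M) : ModelCategory M :=
  { categoryWithFibrations := ⟨ms.fib⟩
    categoryWithCofibrations := ⟨ms.cof⟩
    categoryWithWeakEquivalences := ⟨ms.weq⟩
    cm2 :=
      { comp_mem := fun f g hf hg => ms.weq_comp f g hf hg
        of_postcomp := fun f g hg hfg => ms.weq_of_comp_right f g hg hfg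
        of_precomp := fun f g hf hfg => ms.weq_of_comp_left f g hf hfg }
    cm3a := ⟨fun h hg => ms.weq_retract
      ⟨h.i.left, h.r.left, h.i.right, h.r.right, h.retract_left, h.retract_right, h.i_w, h.r_w⟩ hg⟩
    cm3b := ⟨fun h hg => ms.fib_retract
      ⟨h.i.left, h.r.left, h.i.right, h.r.right, h.retract_left, h.retract_right, h.i_w, h.r_w⟩ hg⟩
    cm3c := ⟨fun h hg => ms.cof_retract
      ⟨h.i.left, h.r.left, h.i.right, h.r.right, h.retract_left, h.retract_right, h.i_w, h.r_w⟩ hg⟩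
    cm4a := fun i p hi hi' hp => ms.lifting_acyclicCof_fib i p hi.mem hi'.mem hp.mem
    cm4b := fun i p hi hp hp' => ms.lifting_cof_acyclicFib i p hi.mem hp.mem hp'.mem
    cm5a := ⟨fun f => by
      obtain ⟨Z, i, p, h1, h2, h3, h4⟩ := ms.factorization_acyclicCof_fib f
      exact ⟨⟨Z, i, p, h4, ⟨h1, h2⟩, h3⟩⟩⟩
    cm5b := ⟨fun f => by
      obtain ⟨Z, i, p, h1, h2, h3, h4⟩ := ms.factorization_cof_acyclicFib f
      exact ⟨⟨Z, i, p, h4, h1, ⟨h2, h3⟩⟩⟩⟩ }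

/-- Given a natural transformation `f` between pushout diagrams
`A₀ ← A₁ → A₂` and `B₀ ← B₁ → B₂`, with each component `fₖ` a weak equivalence and all
objects cofibrant, if `A₁ → A₂` is a cofibration and at least one of `B₁ → B₂`,
`B₁ → B₀` is a cofibration, then the induced morphism of pushouts is a weak
equivalence. -/
theorem weq_pushout_map
    {M : Type u} [Category.{v} M] [HasLimits M] [HasColimits M]
    (ms : ModelStructure M) {A₀ A₁ A₂ B₀ B₁ B₂ : M}
    (a₀ : A₁ ⟶ A₀) (a₂ : A₁ ⟶ A₂) (b₀ : B₁ ⟶ B₀) (b₂ : B₁ ⟶ B₂)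
    (f₀ : A₀ ⟶ B₀) (f₁ : A₁ ⟶ B₁) (f₂ : A₂ ⟶ B₂)
    (e₀ : a₀ ≫ f₀ = f₁ ≫ b₀) (e₂ : a₂ ≫ f₂ = f₁ ≫ b₂)
    (hf₀ : ms.weq f₀) (hf₁ : ms.weq f₁) (hf₂ : ms.weq f₂)
    (hA₀ : ms.Cofibrant A₀) (hA₁ : ms.Cofibrant A₁) (hA₂ : ms.Cofibrant A₂)
    (hB₀ : ms.Cofibrant B₀) (hB₁ : ms.Cofibrant B₁) (hB₂ : ms.Cofibrant B₂)
    (ha₂ : ms.cof a₂) (hb : ms.cof b₂ ∨ ms.cof b₀) :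
    ms.weq (pushout.map a₀ a₂ b₀ b₂ f₀ f₂ f₁ e₀ e₂) := by
  letI : ModelCategory M := ms.toModelCategory
  have : WeakEquivalence f₀ := ⟨hf₀⟩
  have : WeakEquivalence f₁ := ⟨hf₁⟩
  have : WeakEquivalence f₂ := ⟨hf₂⟩
  have : IsCofibrant A₀ := ⟨hA₀⟩
  have : IsCofibrant A₁ := ⟨hA₁⟩
  have : IsCofibrant B₀ := ⟨hB₀⟩
  have : IsCofibrant B₁ := ⟨hB₁⟩
  have : IsCofibrant B₂ := ⟨hB₂⟩
  have : Cofibration a₂ := ⟨ha₂⟩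
  rcases hb with hb | hb
  · have : Cofibration b₂ := ⟨hb⟩
    exact (aux_glue a₀ a₂ b₀ b₂ f₀ f₁ f₂ e₀ e₂).mem
  · have : Cofibration b₀ := ⟨hb⟩
    exact (aux_glue' a₀ a₂ b₀ b₂ f₀ f₁ f₂ e₀ e₂).mem
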